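/- Let F : FreeSymMon(P) → FreeRel(P) be the canonical structure-preserving functor from the free symmetric monoidal category on a set P of generators to the free 'relevant' category on P (the free symmetric monoidal category equipped with a natural cocommutative coassociative diagonal w). Then F is faithful: if two symmetric monoidal morphism terms become equal under the relevant-category equations, they are already equal under the symmetric monoidal equations. -/

import Mathlib

/-- Objects of the free (symmetric monoidal / relevant) category on generators `P`. -/
inductive MObj (P : Type) where
  | letter : P → MObj P
  | unit : MObj P
  | tensor : MObj P → MObj P → MObj P

/-- Morphism terms of the free symmetric monoidal category on `P`. -/
inductive STerm {P : Type} : MObj P → MObj P → Type where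
  | id (A : MObj P) : STerm A A
  | comp {A B C : MObj P} : STerm B C → STerm A B → STerm A C
  | tensor {A B C D : MObj P} : STerm A C → STerm B D → STerm (.tensor A B) (.tensor C D)
  | lunit (A : MObj P) : STerm (.tensor .unit A) A
  | lunitInv (A : MObj P) : STerm A (.tensor .unit A)
  | runit (A : MObj P) : STerm (.tensor A .unit) A
  | runitInv (A : MObj P) : STerm A (.tensor A .unit)
  | assoc (A B C : MObj P) : STerm (.tensor A (.tensor B C)) (.tensor (.tensor A B) C)
  | assocInv (A B C : MObj P) : STerm (.tensor (.tensor A B) C) (.tensor A (.tensor B C))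
  | braid (A B : MObj P) : STerm (.tensor A B) (.tensor B A)

/-- Morphism terms of the free relevant category on `P`:
those of the free symmetric monoidal category together with the diagonal `w`. -/
inductive RTerm {P : Type} : MObj P → MObj P → Type where
  | id (A : MObj P) : RTerm A A
  | comp {A B C : MObj P} : RTerm B C → RTerm A B → RTerm A C
  | tensor {A B C D : MObj P} : RTerm A C → RTerm B D → RTerm (.tensor A B) (.tensor C D)
  | lunit (A : MObj P) : RTerm (.tensor .unit A) A
  | lunitInv (A : MObj P) : RTerm A (.tensor .unit A)
  | runit (A : MObj P) : RTerm (.tensor A .unit) A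
  | runitInv (A : MObj P) : RTerm A (.tensor A .unit)
  | assoc (A B C : MObj P) : RTerm (.tensor A (.tensor B C)) (.tensor (.tensor A B) C)
  | assocInv (A B C : MObj P) : RTerm (.tensor (.tensor A B) C) (.tensor A (.tensor B C))
  | braid (A B : MObj P) : RTerm (.tensor A B) (.tensor B A)
  | diag (A : MObj P) : RTerm A (.tensor A A)

/-- The equations of symmetric monoidal categories, as a congruence on terms. -/
inductive SymEq {P : Type} : {A B : MObj P} → STerm A B → STerm A B → Prop where
  | refl {A B} (f : STerm A B) : SymEq f f
  | symm {A B} {f g : STerm A B} : SymEq f g → SymEq g f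
  | trans {A B} {f g h : STerm A B} : SymEq f g → SymEq g h → SymEq f h
  | compCongr {A B C} {f f' : STerm B C} {g g' : STerm A B} :
      SymEq f f' → SymEq g g' → SymEq (.comp f g) (.comp f' g')
  | tensorCongr {A B C D} {f f' : STerm A C} {g g' : STerm B D} :
      SymEq f f' → SymEq g g' → SymEq (.tensor f g) (.tensor f' g')
  | idLeft {A B} (f : STerm A B) : SymEq (.comp (.id B) f) f
  | idRight {A B} (f : STerm A B) : SymEq (.comp f (.id A)) f
  | assocComp {A B C D} (f : STerm A B) (g : STerm B C) (h : STerm C D) :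
      SymEq (.comp h (.comp g f)) (.comp (.comp h g) f)
  | funct {A B C D E F} (f₁ : STerm A B) (g₁ : STerm B C) (f₂ : STerm D E) (g₂ : STerm E F) :
      SymEq (.tensor (.comp g₁ f₁) (.comp g₂ f₂))
            (.comp (.tensor g₁ g₂) (.tensor f₁ f₂))
  | functId (A B : MObj P) : SymEq (.tensor (.id A) (.id B)) (.id (.tensor A B))
  | lunitNat {A B} (f : STerm A B) :
      SymEq (.comp f (.lunit A)) (.comp (.lunit B) (.tensor (.id .unit) f))
  | runitNat {A B} (f : STerm A B) :
      SymEq (.comp f (.runit A)) (.comp (.runit B) (.tensor f (.id .unit)))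
  | assocNat {A B C D E F} (f : STerm A D) (g : STerm B E) (h : STerm C F) :
      SymEq (.comp (.tensor (.tensor f g) h) (.assoc A B C))
            (.comp (.assoc D E F) (.tensor f (.tensor g h)))
  | braidNat {A B C D} (f : STerm A C) (g : STerm B D) :
      SymEq (.comp (.tensor g f) (.braid A B)) (.comp (.braid C D) (.tensor f g))
  | lunitIso₁ (A : MObj P) : SymEq (.comp (.lunit A) (.lunitInv A)) (.id A)
  | lunitIso₂ (A : MObj P) : SymEq (.comp (.lunitInv A) (.lunit A)) (.id (.tensor .unit A))
  | runitIso₁ (A : MObj P) : SymEq (.comp (.runit A) (.runitInv A)) (.id A)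
  | runitIso₂ (A : MObj P) : SymEq (.comp (.runitInv A) (.runit A)) (.id (.tensor A .unit))
  | assocIso₁ (A B C : MObj P) :
      SymEq (.comp (.assoc A B C) (.assocInv A B C)) (.id (.tensor (.tensor A B) C))
  | assocIso₂ (A B C : MObj P) :
      SymEq (.comp (.assocInv A B C) (.assoc A B C)) (.id (.tensor A (.tensor B C)))
  | unitEq : SymEq (.lunit (.unit : MObj P)) (.runit .unit)
  | triangle (A B : MObj P) :
      SymEq (.comp (.tensor (.runit A) (.id B)) (.assoc A .unit B))
            (.tensor (.id A) (.lunit B))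
  | pentagon (A B C D : MObj P) :
      SymEq (.comp (.assoc (.tensor A B) C D) (.assoc A B (.tensor C D)))
            (.comp (.tensor (.assoc A B C) (.id D))
              (.comp (.assoc A (.tensor B C) D) (.tensor (.id A) (.assoc B C D))))
  | braidInv (A B : MObj P) :
      SymEq (.comp (.braid B A) (.braid A B)) (.id (.tensor A B))
  | braidUnit (A : MObj P) :
      SymEq (.comp (.lunit A) (.braid A .unit)) (.runit A)
  | hexagon (A B C : MObj P) :
      SymEq (.comp (.assoc C A B) (.comp (.braid (.tensor A B) C) (.assoc A B C)))
            (.comp (.tensor (.braid A C) (.id B))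
              (.comp (.assoc A C B) (.tensor (.id A) (.braid B C))))

/-- The middle-four interchange term `c^m_{A,B,C,D}` in the free relevant category. -/
def rMid {P : Type} (A B C D : MObj P) :
    RTerm (.tensor (.tensor A B) (.tensor C D)) (.tensor (.tensor A C) (.tensor B D)) :=
  .comp (.assoc A C (.tensor B D))
    (.comp (.tensor (.id A)
        (.comp (.assocInv C B D) (.comp (.tensor (.braid B C) (.id D)) (.assoc B C D))))
      (.assocInv A B (.tensor C D)))

/-- The equations of relevant categories: those of symmetric monoidal categories
together with the equations for the natural diagonal `w`. -/
inductive RelEq {P : Type} : {A B : MObj P} → RTerm A B → RTerm A B → Prop where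
  | refl {A B} (f : RTerm A B) : RelEq f f
  | symm {A B} {f g : RTerm A B} : RelEq f g → RelEq g f
  | trans {A B} {f g h : RTerm A B} : RelEq f g → RelEq g h → RelEq f h
  | compCongr {A B C} {f f' : RTerm B C} {g g' : RTerm A B} :
      RelEq f f' → RelEq g g' → RelEq (.comp f g) (.comp f' g')
  | tensorCongr {A B C D} {f f' : RTerm A C} {g g' : RTerm B D} :
      RelEq f f' → RelEq g g' → RelEq (.tensor f g) (.tensor f' g')
  | idLeft {A B} (f : RTerm A B) : RelEq (.comp (.id B) f) f
  | idRight {A B} (f : RTerm A B) : RelEq (.comp f (.id A)) f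
  | assocComp {A B C D} (f : RTerm A B) (g : RTerm B C) (h : RTerm C D) :
      RelEq (.comp h (.comp g f)) (.comp (.comp h g) f)
  | funct {A B C D E F} (f₁ : RTerm A B) (g₁ : RTerm B C) (f₂ : RTerm D E) (g₂ : RTerm E F) :
      RelEq (.tensor (.comp g₁ f₁) (.comp g₂ f₂))
            (.comp (.tensor g₁ g₂) (.tensor f₁ f₂))
  | functId (A B : MObj P) : RelEq (.tensor (.id A) (.id B)) (.id (.tensor A B))
  | lunitNat {A B} (f : RTerm A B) :
      RelEq (.comp f (.lunit A)) (.comp (.lunit B) (.tensor (.id .unit) f))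
  | runitNat {A B} (f : RTerm A B) :
      RelEq (.comp f (.runit A)) (.comp (.runit B) (.tensor f (.id .unit)))
  | assocNat {A B C D E F} (f : RTerm A D) (g : RTerm B E) (h : RTerm C F) :
      RelEq (.comp (.tensor (.tensor f g) h) (.assoc A B C))
            (.comp (.assoc D E F) (.tensor f (.tensor g h)))
  | braidNat {A B C D} (f : RTerm A C) (g : RTerm B D) :
      RelEq (.comp (.tensor g f) (.braid A B)) (.comp (.braid C D) (.tensor f g))
  | lunitIso₁ (A : MObj P) : RelEq (.comp (.lunit A) (.lunitInv A)) (.id A)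
  | lunitIso₂ (A : MObj P) : RelEq (.comp (.lunitInv A) (.lunit A)) (.id (.tensor .unit A))
  | runitIso₁ (A : MObj P) : RelEq (.comp (.runit A) (.runitInv A)) (.id A)
  | runitIso₂ (A : MObj P) : RelEq (.comp (.runitInv A) (.runit A)) (.id (.tensor A .unit))
  | assocIso₁ (A B C : MObj P) :
      RelEq (.comp (.assoc A B C) (.assocInv A B C)) (.id (.tensor (.tensor A B) C))
  | assocIso₂ (A B C : MObj P) :
      RelEq (.comp (.assocInv A B C) (.assoc A B C)) (.id (.tensor A (.tensor B C)))
  | unitEq : RelEq (.lunit (.unit : MObj P)) (.runit .unit)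
  | triangle (A B : MObj P) :
      RelEq (.comp (.tensor (.runit A) (.id B)) (.assoc A .unit B))
            (.tensor (.id A) (.lunit B))
  | pentagon (A B C D : MObj P) :
      RelEq (.comp (.assoc (.tensor A B) C D) (.assoc A B (.tensor C D)))
            (.comp (.tensor (.assoc A B C) (.id D))
              (.comp (.assoc A (.tensor B C) D) (.tensor (.id A) (.assoc B C D))))
  | braidInv (A B : MObj P) :
      RelEq (.comp (.braid B A) (.braid A B)) (.id (.tensor A B))
  | braidUnit (A : MObj P) :
      RelEq (.comp (.lunit A) (.braid A .unit)) (.runit A)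
  | hexagon (A B C : MObj P) :
      RelEq (.comp (.assoc C A B) (.comp (.braid (.tensor A B) C) (.assoc A B C)))
            (.comp (.tensor (.braid A C) (.id B))
              (.comp (.assoc A C B) (.tensor (.id A) (.braid B C))))
  | diagNat {A B} (f : RTerm A B) :
      RelEq (.comp (.tensor f f) (.diag A)) (.comp (.diag B) f)
  | diagUnit : RelEq (.comp (.lunit .unit) (.diag (.unit : MObj P))) (.id .unit)
  | diagAssoc (A : MObj P) :
      RelEq (.comp (.assoc A A A) (.comp (.tensor (.id A) (.diag A)) (.diag A)))
            (.comp (.tensor (.diag A) (.id A)) (.diag A))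
  | diagComm (A : MObj P) : RelEq (.comp (.braid A A) (.diag A)) (.diag A)
  | diagMid (A B : MObj P) :
      RelEq (.comp (rMid A B A B) (.diag (.tensor A B))) (.tensor (.diag A) (.diag B))

/-- The canonical structure-preserving functor `FreeSymMon(P) → FreeRel(P)`
(it is the identity on objects). -/
def embed {P : Type} : {A B : MObj P} → STerm A B → RTerm A B
  | _, _, .id A => .id A
  | _, _, .comp f g => .comp (embed f) (embed g)
  | _, _, .tensor f g => .tensor (embed f) (embed g)
  | _, _, .lunit A => .lunit A
  | _, _, .lunitInv A => .lunitInv A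
  | _, _, .runit A => .runit A
  | _, _, .runitInv A => .runitInv A
  | _, _, .assoc A B C => .assoc A B C
  | _, _, .assocInv A B C => .assocInv A B C
  | _, _, .braid A B => .braid A B

open CategoryTheory MonoidalCategory

namespace CategoryTheory.MonoidalCategory

variable {C : Type*} [Category C] [MonoidalCategory C] {p : C}

/-- Pull a factor `p` of the left tensorand out to the front. -/
def extractLeft {A A' : C} (e : A ≅ p ⊗ A') (B : C) : A ⊗ B ≅ p ⊗ (A' ⊗ B) :=
  whiskerRightIso e B ≪≫ α_ p A' B

theorem tensorHom_extractLeft {A A' B B' D E : C} {e : A ≅ p ⊗ A'} {e' : B ≅ p ⊗ B'}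
    {f : A ⟶ B} {f' : A' ⟶ B'} (h : f ≫ e'.hom = e.hom ≫ p ◁ f') (g : D ⟶ E) :
    (f ⊗ₘ g) ≫ (extractLeft e' E).hom = (extractLeft e D).hom ≫ p ◁ (f' ⊗ₘ g) := by
  have h' := congrArg (fun k => k ▷ D) h
  simp only [comp_whiskerRight] at h'
  simp only [extractLeft, Iso.trans_hom, whiskerRightIso_hom, Category.assoc]
  rw [MonoidalCategory.tensorHom_def, MonoidalCategory.tensorHom_def, Category.assoc,
    whisker_exchange_assoc, reassoc_of% h']
  simp

theorem rightUnitor_extract {A A' : C} (e : A ≅ p ⊗ A') :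
    (ρ_ A).hom ≫ e.hom = (extractLeft e (𝟙_ C)).hom ≫ p ◁ (ρ_ A').hom := by
  simp [extractLeft]

theorem associator_extract_left {A A' : C} (e : A ≅ p ⊗ A') (B D : C) :
    (α_ A B D).hom ≫ (extractLeft e (B ⊗ D)).hom =
      (extractLeft (extractLeft e B) D).hom ≫ p ◁ (α_ A' B D).hom := by
  simp [extractLeft]

/-- The square for `f.inv` obtained from the one for `f`. -/
theorem inv_comp_eq_of_comp_eq {A A' B B' : C} {e : A ≅ p ⊗ A'} {e' : B ≅ p ⊗ B'} {f : A ≅ B}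
    {f' : A' ≅ B'} (h : f.hom ≫ e'.hom = e.hom ≫ p ◁ f'.hom) :
    f.inv ≫ e.hom = e'.hom ≫ p ◁ f'.inv := by
  rw [Iso.inv_comp_eq, reassoc_of% h]
  simp

theorem associator_tensorHom_leftUnitor {A B D : C} (a : A ⟶ 𝟙_ C) (b : B ⟶ 𝟙_ C)
    (d : D ⟶ 𝟙_ C) :
    (α_ A B D).hom ≫ (a ⊗ₘ ((b ⊗ₘ d) ≫ (λ_ _).hom)) ≫ (λ_ _).hom =
      (((a ⊗ₘ b) ≫ (λ_ _).hom) ⊗ₘ d) ≫ (λ_ _).hom := by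
  have h₁ : a ⊗ₘ ((b ⊗ₘ d) ≫ (λ_ _).hom) = (a ⊗ₘ (b ⊗ₘ d)) ≫ _ ◁ (λ_ _).hom := by
    rw [← id_tensorHom, tensorHom_comp_tensorHom, Category.comp_id]
  have h₂ : ((a ⊗ₘ b) ≫ (λ_ _).hom) ⊗ₘ d = ((a ⊗ₘ b) ⊗ₘ d) ≫ (λ_ _).hom ▷ _ := by
    rw [← tensorHom_id, tensorHom_comp_tensorHom, Category.comp_id]
  rw [h₁, h₂, Category.assoc, Category.assoc, ← associator_naturality_assoc,
    triangle_assoc, unitors_equal]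

theorem id_comp_eq_comp_whiskerLeft {A A' : C} (e : A ⟶ p ⊗ A') :
    𝟙 A ≫ e = e ≫ p ◁ 𝟙 A' := by simp

theorem comp_comp_eq_comp_whiskerLeft {A A' B B' D D' : C} {e : A ⟶ p ⊗ A'} {e' : B ⟶ p ⊗ B'}
    {e'' : D ⟶ p ⊗ D'} {f : A ⟶ B} {g : B ⟶ D} {f' : A' ⟶ B'} {g' : B' ⟶ D'}
    (hf : f ≫ e' = e ≫ p ◁ f') (hg : g ≫ e'' = e' ≫ p ◁ g') :
    (f ≫ g) ≫ e'' = e ≫ p ◁ (f' ≫ g') := by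
  rw [Category.assoc, hg, reassoc_of% hf, MonoidalCategory.whiskerLeft_comp]

variable [SymmetricCategory C]

/-- Pull a factor `p` of the right tensorand out to the front. -/
def extractRight (A : C) {B B' : C} (e : B ≅ p ⊗ B') : A ⊗ B ≅ p ⊗ (A ⊗ B') :=
  whiskerLeftIso A e ≪≫ (α_ A p B').symm ≪≫ whiskerRightIso (β_ A p) B' ≪≫ α_ p A B'

theorem tensorHom_extractRight {A A' B B' D E : C} {e : A ≅ p ⊗ A'} {e' : B ≅ p ⊗ B'}
    {f : A ⟶ B} {f' : A' ⟶ B'} (h : f ≫ e'.hom = e.hom ≫ p ◁ f') (g : D ⟶ E) :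
    (g ⊗ₘ f) ≫ (extractRight E e').hom = (extractRight D e).hom ≫ p ◁ (g ⊗ₘ f') := by
  have h' := congrArg (fun k => D ◁ k) h
  simp only [whiskerLeft_comp] at h'
  simp only [extractRight, Iso.trans_hom, whiskerLeftIso_hom, tensorHom_def', Category.assoc,
    MonoidalCategory.whiskerLeft_comp, Iso.symm_hom, whiskerRightIso_hom]
  rw [← whisker_exchange_assoc, reassoc_of% h']
  rw [associator_inv_naturality_left_assoc, associator_inv_naturality_right_assoc,
    ← comp_whiskerRight_assoc, BraidedCategory.braiding_naturality_left, comp_whiskerRight_assoc,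
    whisker_exchange_assoc]
  simp

theorem leftUnitor_extract {A A' : C} (e : A ≅ p ⊗ A') :
    (λ_ A).hom ≫ e.hom = (extractRight (𝟙_ C) e).hom ≫ p ◁ (λ_ A').hom := by
  simp [extractRight, braiding_tensorUnit_left]

theorem associator_extract_middle (A : C) {B B' : C} (e : B ≅ p ⊗ B') (D : C) :
    (α_ A B D).hom ≫ (extractRight A (extractLeft e D)).hom =
      (extractLeft (extractRight A e) D).hom ≫ p ◁ (α_ A B' D).hom := by
  simp [extractLeft, extractRight]

theorem associator_extract_right (A B : C) {D D' : C} (e : D ≅ p ⊗ D') :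
    (α_ A B D).hom ≫ (extractRight A (extractRight B e)).hom =
      (extractRight (A ⊗ B) e).hom ≫ p ◁ (α_ A B D').hom := by
  simp [extractRight]

theorem braiding_extract_left {A A' : C} (e : A ≅ p ⊗ A') (B : C) :
    (β_ A B).hom ≫ (extractRight B e).hom = (extractLeft e B).hom ≫ p ◁ (β_ A' B).hom := by
  simp only [extractLeft, extractRight, Iso.trans_hom, whiskerLeftIso_hom, whiskerRightIso_hom,
    Iso.symm_hom, Category.assoc]
  rw [← BraidedCategory.braiding_naturality_left_assoc]
  simp [← comp_whiskerRight_assoc]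

theorem braiding_extract_right (A : C) {B B' : C} (e : B ≅ p ⊗ B') :
    (β_ A B).hom ≫ (extractLeft e A).hom = (extractRight A e).hom ≫ p ◁ (β_ A B').hom := by
  simp only [extractLeft, extractRight, Iso.trans_hom, whiskerLeftIso_hom, whiskerRightIso_hom,
    Iso.symm_hom, Category.assoc]
  rw [← BraidedCategory.braiding_naturality_right_assoc]
  simp

end CategoryTheory.MonoidalCategory

instance symSetoid {P : Type} (A B : MObj P) : Setoid (STerm A B) :=
  ⟨SymEq, ⟨.refl, .symm, .trans⟩⟩

instance symCategory {P : Type} : Category (MObj P) where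
  Hom A B := Quotient (symSetoid A B)
  id A := ⟦.id A⟧
  comp := Quotient.map₂ (fun f g => .comp g f) (fun _ _ hf _ _ hg => .compCongr hg hf)
  id_comp := by
    rintro A B ⟨f⟩
    exact Quotient.sound (.idRight f)
  comp_id := by
    rintro A B ⟨f⟩
    exact Quotient.sound (.idLeft f)
  assoc := by
    rintro A B C D ⟨f⟩ ⟨g⟩ ⟨h⟩
    exact Quotient.sound (.assocComp f g h)

/-- The class of a term, as a morphism of the free symmetric monoidal category. -/
def STerm.toHom {P : Type} {A B : MObj P} (f : STerm A B) : A ⟶ B := ⟦f⟧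

theorem exists_toHom_eq {P : Type} {A B : MObj P} (f : A ⟶ B) : ∃ t : STerm A B, t.toHom = f :=
  Quotient.exists_rep f

/-- Tensor product of morphisms of the free symmetric monoidal category. -/
def symTensorHom {P : Type} {A B C D : MObj P} : (A ⟶ C) → (B ⟶ D) →
    (MObj.tensor A B ⟶ MObj.tensor C D) :=
  Quotient.map₂ .tensor (fun _ _ hf _ _ hg => .tensorCongr hf hg)

instance symMonoidalStruct {P : Type} : MonoidalCategoryStruct (MObj P) where
  tensorObj := .tensor
  tensorUnit := .unit
  tensorHom := symTensorHom
  whiskerLeft A _ _ f := symTensorHom (𝟙 A) f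
  whiskerRight f A := symTensorHom f (𝟙 A)
  associator A B C := ⟨(STerm.assocInv A B C).toHom, (STerm.assoc A B C).toHom,
    Quotient.sound (.assocIso₁ A B C), Quotient.sound (.assocIso₂ A B C)⟩
  leftUnitor A := ⟨(STerm.lunit A).toHom, (STerm.lunitInv A).toHom,
    Quotient.sound (.lunitIso₂ A), Quotient.sound (.lunitIso₁ A)⟩
  rightUnitor A := ⟨(STerm.runit A).toHom, (STerm.runitInv A).toHom,
    Quotient.sound (.runitIso₂ A), Quotient.sound (.runitIso₁ A)⟩

theorem symTensor_comp {P : Type} {A B C D E F : MObj P} (f₁ : A ⟶ B) (f₂ : D ⟶ E) (g₁ : B ⟶ C)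
    (g₂ : E ⟶ F) : (f₁ ⊗ₘ f₂) ≫ (g₁ ⊗ₘ g₂) = (f₁ ≫ g₁) ⊗ₘ (f₂ ≫ g₂) := by
  obtain ⟨f₁⟩ := f₁
  obtain ⟨f₂⟩ := f₂
  obtain ⟨g₁⟩ := g₁
  obtain ⟨g₂⟩ := g₂
  exact (Quotient.sound (SymEq.funct f₁ g₁ f₂ g₂)).symm

theorem symTensor_id {P : Type} (A B : MObj P) : (𝟙 A ⊗ₘ 𝟙 B) = 𝟙 (A ⊗ B) :=
  Quotient.sound (.functId A B)

theorem symAssociator_naturality {P : Type} {A B C D E F : MObj P} (f : A ⟶ D) (g : B ⟶ E)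
    (h : C ⟶ F) :
    ((f ⊗ₘ g) ⊗ₘ h) ≫ (α_ D E F).hom = (α_ A B C).hom ≫ (f ⊗ₘ (g ⊗ₘ h)) := by
  rw [← Iso.inv_comp_eq, ← Category.assoc, ← Iso.eq_comp_inv]
  obtain ⟨f⟩ := f
  obtain ⟨g⟩ := g
  obtain ⟨h⟩ := h
  exact Quotient.sound (.assocNat f g h)

/-- Tensoring isomorphisms, available before the monoidal category instance. -/
def symTensorIso {P : Type} {A B C D : MObj P} (f : A ≅ C) (g : B ≅ D) : A ⊗ B ≅ C ⊗ D where
  hom := f.hom ⊗ₘ g.hom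
  inv := f.inv ⊗ₘ g.inv
  hom_inv_id := by rw [symTensor_comp, f.hom_inv_id, g.hom_inv_id, symTensor_id]
  inv_hom_id := by rw [symTensor_comp, f.inv_hom_id, g.inv_hom_id, symTensor_id]

instance symMonoidal {P : Type} : MonoidalCategory (MObj P) :=
  MonoidalCategory.ofTensorHom
    (id_tensorHom_id := symTensor_id)
    (id_tensorHom := fun _ _ _ _ => rfl)
    (tensorHom_id := fun _ _ => rfl)
    (tensorHom_comp_tensorHom := symTensor_comp)
    (associator_naturality := symAssociator_naturality)
    (leftUnitor_naturality := by
      rintro A B ⟨f⟩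
      exact (Quotient.sound (SymEq.lunitNat f)).symm)
    (rightUnitor_naturality := by
      rintro A B ⟨f⟩
      exact (Quotient.sound (SymEq.runitNat f)).symm)
    (pentagon := fun A B C D => by
      have h : (symTensorIso (α_ A B C) (Iso.refl D) ≪≫ α_ A (B ⊗ C) D ≪≫
          symTensorIso (Iso.refl A) (α_ B C D)) = α_ (A ⊗ B) C D ≪≫ α_ A B (C ⊗ D) := by
        apply Iso.ext_inv
        simp only [Iso.trans_inv]
        exact (Quotient.sound (SymEq.pentagon A B C D)).symm
      exact congrArg Iso.hom h)
    (triangle := fun A B => by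
      rw [← Iso.eq_inv_comp]
      exact (Quotient.sound (SymEq.triangle A B)).symm)

/-- The braiding of the free symmetric monoidal category. -/
def symBraiding {P : Type} (A B : MObj P) : A ⊗ B ≅ B ⊗ A where
  hom := (STerm.braid A B).toHom
  inv := (STerm.braid B A).toHom
  hom_inv_id := Quotient.sound (.braidInv A B)
  inv_hom_id := Quotient.sound (.braidInv B A)

theorem symHexagon {P : Type} (A B C : MObj P) :
    (α_ A B C).inv ≫ (symBraiding (A ⊗ B) C).hom ≫ (α_ C A B).inv =
      (A ◁ (symBraiding B C).hom) ≫ (α_ A C B).inv ≫ ((symBraiding A C).hom ▷ B) := by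
  rw [← Category.assoc, ← Category.assoc]
  exact Quotient.sound (.hexagon A B C)

instance symSymmetric {P : Type} : SymmetricCategory (MObj P) where
  braiding := symBraiding
  braiding_naturality_right := by
    rintro A B C ⟨f⟩
    exact Quotient.sound (.symm (.braidNat (.id A) f))
  braiding_naturality_left := by
    rintro A B ⟨f⟩ C
    exact Quotient.sound (.symm (.braidNat f (.id C)))
  hexagon_forward A B C := by
    have h : α_ A B C ≪≫ symBraiding A (B ⊗ C) ≪≫ α_ B C A =
        whiskerRightIso (symBraiding A B) C ≪≫ α_ B A C ≪≫ whiskerLeftIso B (symBraiding A C) := by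
      apply Iso.ext_inv
      simp only [Iso.trans_inv, Category.assoc]
      exact symHexagon B C A
    exact congrArg Iso.hom h
  hexagon_reverse := symHexagon
  symmetry A B := Quotient.sound (.braidInv A B)

/-- Occurrences of the letter `p` in an object. -/
inductive MObj.Pos {P : Type} : MObj P → P → Type where
  | here (p : P) : Pos (.letter p) p
  | inl {A B : MObj P} {p : P} : Pos A p → Pos (.tensor A B) p
  | inr {A B : MObj P} {p : P} : Pos B p → Pos (.tensor A B) p

open MObj

/-- The map on tensor products induced by two maps of occurrences. -/
def MObj.Pos.map {P : Type} {A B C D : MObj P} {p : P} (f : Pos A p → Pos C p)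
    (g : Pos B p → Pos D p) : Pos (.tensor A B) p → Pos (.tensor C D) p
  | .inl x => .inl (f x)
  | .inr x => .inr (g x)

/-- The origin in the source of an occurrence of a letter in the target. -/
def RTerm.origin {P : Type} {p : P} : {A B : MObj P} → RTerm A B → Pos B p → Pos A p
  | _, _, .id _, x => x
  | _, _, .comp f g, x => g.origin (f.origin x)
  | _, _, .tensor f g, x => Pos.map f.origin g.origin x
  | _, _, .lunit _, x => .inr x
  | _, _, .lunitInv _, .inr x => x
  | _, _, .runit _, x => .inl x
  | _, _, .runitInv _, .inl x => x
  | _, _, .assoc _ _ _, .inl (.inl x) => .inl x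
  | _, _, .assoc _ _ _, .inl (.inr x) => .inr (.inl x)
  | _, _, .assoc _ _ _, .inr x => .inr (.inr x)
  | _, _, .assocInv _ _ _, .inl x => .inl (.inl x)
  | _, _, .assocInv _ _ _, .inr (.inl x) => .inl (.inr x)
  | _, _, .assocInv _ _ _, .inr (.inr x) => .inr x
  | _, _, .braid _ _, .inl x => .inr x
  | _, _, .braid _ _, .inr x => .inl x
  | _, _, .diag _, .inl x => x
  | _, _, .diag _, .inr x => x

theorem RelEq.origin_eq {P : Type} {p : P} {A B : MObj P} {f g : RTerm A B} (h : RelEq f g)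
    (x : Pos B p) : f.origin x = g.origin x := by
  induction h with
  | refl => rfl
  | symm _ ih => exact (ih x).symm
  | trans _ _ ih₁ ih₂ => exact (ih₁ x).trans (ih₂ x)
  | compCongr _ _ ih₁ ih₂ => simp only [RTerm.origin, ih₁, ih₂]
  | tensorCongr _ _ ih₁ ih₂ => cases x <;> simp only [RTerm.origin, Pos.map, ih₁, ih₂]
  | idLeft | idRight | assocComp | lunitNat | runitNat | lunitIso₁ | runitIso₁ => rfl
  | unitEq => cases x
  | diagUnit => cases x
  | diagNat => rcases x with _ | _ | _ <;> rfl
  | diagMid => rcases x with _ | (_ | _ | _) | (_ | _ | _) <;> rfl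
  | diagAssoc | assocNat | assocIso₁ | hexagon => rcases x with _ | (_ | _) | _ <;> rfl
  | assocIso₂ | triangle => rcases x with _ | _ | (_ | _) <;> rfl
  | pentagon => rcases x with _ | (_ | (_ | _) | _) | _ <;> rfl
  | lunitIso₂ => rcases x with _ | (_ | _) | _; rfl
  | runitIso₂ => rcases x with _ | _ | (_ | _); rfl
  | _ => rcases x with _ | _ | _ <;> rfl

theorem SymEq.relEq_embed {P : Type} {A B : MObj P} {f g : STerm A B} (h : SymEq f g) :
    RelEq (embed f) (embed g) := by
  induction h with
  | refl => exact .refl _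
  | symm _ ih => exact ih.symm
  | trans _ _ ih₁ ih₂ => exact ih₁.trans ih₂
  | compCongr _ _ ih₁ ih₂ => exact .compCongr ih₁ ih₂
  | tensorCongr _ _ ih₁ ih₂ => exact .tensorCongr ih₁ ih₂
  | idLeft => exact .idLeft _
  | idRight => exact .idRight _
  | assocComp => exact .assocComp _ _ _
  | funct => exact .funct _ _ _ _
  | functId => exact .functId _ _
  | lunitNat => exact .lunitNat _
  | runitNat => exact .runitNat _
  | assocNat => exact .assocNat _ _ _
  | braidNat => exact .braidNat _ _
  | lunitIso₁ => exact .lunitIso₁ _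
  | lunitIso₂ => exact .lunitIso₂ _
  | runitIso₁ => exact .runitIso₁ _
  | runitIso₂ => exact .runitIso₂ _
  | assocIso₁ => exact .assocIso₁ _ _ _
  | assocIso₂ => exact .assocIso₂ _ _ _
  | unitEq => exact .unitEq
  | triangle => exact .triangle _ _
  | pentagon => exact .pentagon _ _ _ _
  | braidInv => exact .braidInv _ _
  | braidUnit => exact .braidUnit _
  | hexagon => exact .hexagon _ _ _

/-- The origin map of a morphism of the free symmetric monoidal category. -/
def symOrigin {P : Type} {A B : MObj P} (f : A ⟶ B) (p : P) : Pos B p → Pos A p :=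
  Quotient.lift (fun t => (embed t).origin)
    (fun _ _ h => funext fun x => (SymEq.relEq_embed h).origin_eq x) f

theorem symOrigin_comp {P : Type} {A B C : MObj P} (f : A ⟶ B) (g : B ⟶ C) (p : P) (x : Pos C p) :
    symOrigin (f ≫ g) p x = symOrigin f p (symOrigin g p x) := by
  obtain ⟨f, rfl⟩ := exists_toHom_eq f
  obtain ⟨g, rfl⟩ := exists_toHom_eq g
  rfl

theorem symOrigin_id {P : Type} (A : MObj P) (p : P) (x : Pos A p) :
    symOrigin (𝟙 A) p x = x :=
  rfl

theorem symOrigin_whiskerLeft_inr {P : Type} (A : MObj P) {B C : MObj P} (f : B ⟶ C) (p : P)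
    (x : Pos C p) : symOrigin (A ◁ f) p (.inr x) = .inr (symOrigin f p x) := by
  obtain ⟨f, rfl⟩ := exists_toHom_eq f
  rfl

theorem symOrigin_hom_injective {P : Type} {A B : MObj P} (e : A ≅ B) (p : P) :
    Function.Injective (symOrigin e.hom p) := by
  refine Function.LeftInverse.injective (g := symOrigin e.inv p) fun x => ?_
  rw [← symOrigin_comp, e.inv_hom_id, symOrigin_id]

/-- The object obtained by deleting an occurrence of a letter. -/
def MObj.erase {P : Type} {p : P} : {A : MObj P} → Pos A p → MObj P
  | _, .here _ => .unit
  | .tensor _ B, .inl x => .tensor (erase x) B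
  | .tensor A _, .inr x => .tensor A (erase x)

/-- Pull an occurrence of a letter out to the front. -/
def extract {P : Type} {p : P} : {A : MObj P} → (x : Pos A p) → (A ≅ letter p ⊗ erase x)
  | _, .here p => (ρ_ (letter p)).symm
  | .tensor _ B, .inl x => MonoidalCategory.extractLeft (extract x) B
  | .tensor A _, .inr x => MonoidalCategory.extractRight A (extract x)

/-- Every morphism restricts to the complement of an occurrence of a letter and its origin. -/
theorem exists_extract_comm {P : Type} {p : P} {A B : MObj P} (f : A ⟶ B) (x : Pos B p) :
    ∃ f' : erase (symOrigin f p x) ⟶ erase x,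
      f ≫ (extract x).hom = (extract (symOrigin f p x)).hom ≫ letter p ◁ f' := by
  obtain ⟨t, rfl⟩ := exists_toHom_eq f
  induction t with
  | id A =>
    exact ⟨𝟙 (erase x), id_comp_eq_comp_whiskerLeft (extract x).hom⟩
  | @comp A B C f g ihf ihg =>
    obtain ⟨f', hf⟩ := ihf x
    obtain ⟨g', hg⟩ := ihg (symOrigin f.toHom p x)
    exact ⟨g' ≫ f', comp_comp_eq_comp_whiskerLeft hg hf⟩
  | tensor f g ihf ihg =>
    cases x with
    | inl x =>
      obtain ⟨f', hf⟩ := ihf x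
      exact ⟨f' ⊗ₘ g.toHom, tensorHom_extractLeft hf g.toHom⟩
    | inr x =>
      obtain ⟨g', hg⟩ := ihg x
      exact ⟨f.toHom ⊗ₘ g', tensorHom_extractRight hg f.toHom⟩
  | lunit A => exact ⟨(λ_ (erase x)).hom, leftUnitor_extract (extract x)⟩
  | lunitInv A =>
    rcases x with _ | x | x
    · cases x
    · exact ⟨(λ_ (erase x)).inv, inv_comp_eq_of_comp_eq (f := λ_ A) (f' := λ_ (erase x))
        (leftUnitor_extract (extract x))⟩
  | runit A => exact ⟨(ρ_ (erase x)).hom, rightUnitor_extract (extract x)⟩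
  | runitInv A =>
    rcases x with _ | x | x
    · exact ⟨(ρ_ (erase x)).inv, inv_comp_eq_of_comp_eq (f := ρ_ A) (f' := ρ_ (erase x))
        (rightUnitor_extract (extract x))⟩
    · cases x
  | assoc A B C =>
    rcases x with _ | (_ | x | x) | x
    · exact ⟨(α_ (erase x) B C).inv, inv_comp_eq_of_comp_eq (f := α_ A B C)
        (f' := α_ (erase x) B C) (associator_extract_left (extract x) B C)⟩
    · exact ⟨(α_ A (erase x) C).inv, inv_comp_eq_of_comp_eq (f := α_ A B C)
        (f' := α_ A (erase x) C) (associator_extract_middle A (extract x) C)⟩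
    · exact ⟨(α_ A B (erase x)).inv, inv_comp_eq_of_comp_eq (f := α_ A B C)
        (f' := α_ A B (erase x)) (associator_extract_right A B (extract x))⟩
  | assocInv A B C =>
    rcases x with _ | x | (_ | x | x)
    · exact ⟨(α_ (erase x) B C).hom, associator_extract_left (extract x) B C⟩
    · exact ⟨(α_ A (erase x) C).hom, associator_extract_middle A (extract x) C⟩
    · exact ⟨(α_ A B (erase x)).hom, associator_extract_right A B (extract x)⟩
  | braid A B =>
    rcases x with _ | x | x
    · exact ⟨(β_ A (erase x)).hom, braiding_extract_right A (extract x)⟩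
    · exact ⟨(β_ (erase x) B).hom, braiding_extract_left (extract x) B⟩

/-- The number of occurrences of letters in an object. -/
def MObj.length {P : Type} : MObj P → ℕ
  | .letter _ => 1
  | .unit => 0
  | .tensor A B => A.length + B.length

theorem STerm.length_eq {P : Type} {A B : MObj P} (f : STerm A B) : A.length = B.length := by
  induction f <;> (try simp only [MObj.length]) <;> omega

theorem MObj.length_erase {P : Type} {p : P} {A : MObj P} (x : Pos A p) :
    (erase x).length + 1 = A.length := by
  induction x <;> simp only [MObj.length, erase] at * <;> omega

theorem MObj.exists_pos {P : Type} {A : MObj P} (h : A.length ≠ 0) : ∃ p, Nonempty (Pos A p) := by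
  induction A with
  | letter p => exact ⟨p, ⟨.here p⟩⟩
  | unit => exact absurd rfl h
  | tensor A B ihA ihB =>
    by_cases hA : A.length = 0
    · obtain ⟨p, ⟨x⟩⟩ := ihB (by simp only [length] at h; omega)
      exact ⟨p, ⟨.inr x⟩⟩
    · obtain ⟨p, ⟨x⟩⟩ := ihA hA
      exact ⟨p, ⟨.inl x⟩⟩

/-- An object without letters is isomorphic to the unit. -/
def collapse {P : Type} : (A : MObj P) → A.length = 0 → (A ≅ 𝟙_ (MObj P))
  | .letter _, h => absurd h one_ne_zero
  | .unit, _ => Iso.refl _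
  | .tensor A B, h =>
    (collapse A (Nat.eq_zero_of_add_eq_zero_right h) ⊗ᵢ
      collapse B (Nat.eq_zero_of_add_eq_zero_left h)) ≪≫ λ_ _

theorem collapse_tensor {P : Type} {A B : MObj P} (hA : A.length = 0) (hB : B.length = 0)
    (h : (A ⊗ B).length = 0) :
    (collapse (A ⊗ B) h).hom = ((collapse A hA).hom ⊗ₘ (collapse B hB).hom) ≫ (λ_ _).hom :=
  rfl

theorem toHom_comp_collapse {P : Type} {A B : MObj P} (f : STerm A B) (hA : A.length = 0)
    (hB : B.length = 0) : f.toHom ≫ (collapse B hB).hom = (collapse A hA).hom := by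
  have unitTensor {A : MObj P} (hA : A.length = 0) (h : (𝟙_ (MObj P) ⊗ A).length = 0) :
      (λ_ A).hom ≫ (collapse A hA).hom = (collapse (𝟙_ (MObj P) ⊗ A) h).hom := by
    refine Eq.trans ?_ (collapse_tensor (A := 𝟙_ (MObj P)) rfl hA h).symm
    change _ = (𝟙 (𝟙_ (MObj P)) ⊗ₘ (collapse A hA).hom) ≫ (λ_ _).hom
    rw [id_tensorHom, leftUnitor_naturality]
  have tensorUnit {A : MObj P} (hA : A.length = 0) (h : (A ⊗ 𝟙_ (MObj P)).length = 0) :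
      (ρ_ A).hom ≫ (collapse A hA).hom = (collapse (A ⊗ 𝟙_ (MObj P)) h).hom := by
    refine Eq.trans ?_ (collapse_tensor (B := 𝟙_ (MObj P)) hA rfl h).symm
    change _ = ((collapse A hA).hom ⊗ₘ 𝟙 (𝟙_ (MObj P))) ≫ (λ_ _).hom
    rw [tensorHom_id, unitors_equal, rightUnitor_naturality]
  have associator {A B C : MObj P} (h : ((A ⊗ B) ⊗ C).length = 0)
      (h' : (A ⊗ B ⊗ C).length = 0) :
      (α_ A B C).hom ≫ (collapse (A ⊗ B ⊗ C) h').hom = (collapse ((A ⊗ B) ⊗ C) h).hom := by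
    have hAB := Nat.eq_zero_of_add_eq_zero_right h
    have hBC := Nat.eq_zero_of_add_eq_zero_left h'
    rw [collapse_tensor (Nat.eq_zero_of_add_eq_zero_right h') hBC,
      collapse_tensor hAB (Nat.eq_zero_of_add_eq_zero_left h),
      collapse_tensor (Nat.eq_zero_of_add_eq_zero_right hAB) (Nat.eq_zero_of_add_eq_zero_left hAB),
      collapse_tensor (Nat.eq_zero_of_add_eq_zero_right hBC) (Nat.eq_zero_of_add_eq_zero_left hBC)]
    exact associator_tensorHom_leftUnitor _ _ _
  induction f with
  | id A => exact Category.id_comp _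
  | comp f g ihf ihg =>
    have h := f.length_eq.trans hB
    rw [← ihg hA h, ← ihf h hB]
    exact Category.assoc g.toHom f.toHom _
  | tensor f g ihf ihg =>
    change (f.toHom ⊗ₘ g.toHom) ≫ _ = _
    have hA₁ := Nat.eq_zero_of_add_eq_zero_right hA
    have hA₂ := Nat.eq_zero_of_add_eq_zero_left hA
    have hB₁ := Nat.eq_zero_of_add_eq_zero_right hB
    have hB₂ := Nat.eq_zero_of_add_eq_zero_left hB
    refine Eq.trans ?_ (collapse_tensor hA₁ hA₂ hA).symm
    rw [← ihf hA₁ hB₁, ← ihg hA₂ hB₂, ← tensorHom_comp_tensorHom, Category.assoc]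
    rfl
  | lunit A => exact unitTensor hB hA
  | lunitInv A => exact (Iso.inv_comp_eq (λ_ A)).2 (unitTensor hA hB).symm
  | runit A => exact tensorUnit hB hA
  | runitInv A => exact (Iso.inv_comp_eq (ρ_ A)).2 (tensorUnit hA hB).symm
  | assoc A B C => exact (Iso.inv_comp_eq (α_ A B C)).2 (associator hB hA).symm
  | assocInv A B C => exact associator hA hB
  | braid A B =>
    have hA₁ := Nat.eq_zero_of_add_eq_zero_right hA
    have hA₂ := Nat.eq_zero_of_add_eq_zero_left hA
    change (β_ A B).hom ≫ _ = _
    refine Eq.trans ?_ (collapse_tensor hA₁ hA₂ hA).symm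
    refine (congrArg (_ ≫ ·) (collapse_tensor hA₂ hA₁ hB)).trans ?_
    rw [← BraidedCategory.braiding_naturality_assoc,
      braiding_leftUnitor, unitors_equal]

/-- Coherence: a morphism of the free symmetric monoidal category is determined by its origin
map. -/
theorem eq_of_symOrigin_eq {P : Type} {A B : MObj P} (f g : A ⟶ B)
    (h : ∀ p, symOrigin f p = symOrigin g p) : f = g := by
  induction hn : B.length generalizing A B with
  | zero =>
    obtain ⟨f, rfl⟩ := exists_toHom_eq f
    obtain ⟨g, rfl⟩ := exists_toHom_eq g
    have hA := f.length_eq.trans hn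
    rw [← cancel_mono (collapse B hn).hom]
    exact (toHom_comp_collapse f hA hn).trans (toHom_comp_collapse g hA hn).symm
  | succ n ih =>
    obtain ⟨p, ⟨x⟩⟩ := MObj.exists_pos (A := B) (by omega)
    obtain ⟨f', hf⟩ := exists_extract_comm f x
    obtain ⟨g', hg⟩ := exists_extract_comm g x
    generalize hy : symOrigin f p x = y at f' hf
    rw [h] at hy
    subst hy
    have key : f' = g' := by
      refine ih f' g' (fun q => ?_) (by have := length_erase x; omega)
      funext z
      have hz : symOrigin ((extract (symOrigin g p x)).hom ≫ letter p ◁ f') q (.inr z) =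
          symOrigin ((extract (symOrigin g p x)).hom ≫ letter p ◁ g') q (.inr z) := by
        rw [← hf, ← hg, symOrigin_comp, symOrigin_comp, h]
      rw [symOrigin_comp, symOrigin_comp] at hz
      have hz' := symOrigin_hom_injective _ q hz
      rw [symOrigin_whiskerLeft_inr, symOrigin_whiskerLeft_inr] at hz'
      exact Pos.inr.inj hz'
    rw [← cancel_mono (extract x).hom, hf, hg, key]

/-- The canonical functor from the free symmetric monoidal category to the free
relevant category is faithful: two symmetric monoidal morphism terms equal under
the relevant-category equations are already equal under the symmetric monoidal
equations. -/
theorem stmt19 {P : Type} {A B : MObj P} (f g : STerm A B)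
    (h : RelEq (embed f) (embed g)) : SymEq f g :=
  Quotient.exact (eq_of_symOrigin_eq f.toHom g.toHom fun _ => funext h.origin_eq)
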